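/- Let m ≤ n be positive integers, let g ∈ L²(γ_m), and let U, V ∈ ℝ^{m×n} be matrices satisfying U Uᵀ = V Vᵀ = I_m. Then E_{x∼γ_n}[g(Ux) g(Vx)] ≤ Σ_{t=0}^∞ ‖U Vᵀ‖₂^t · E_{x∼γ_m}[(g^{[t]}(x))²], where ‖·‖₂ denotes the matrix operator (spectral) norm. -/

import Mathlib

open MeasureTheory ProbabilityTheory

/-- The standard `n`-dimensional Gaussian distribution `N(0, I_n)` on `ℝ^n`. -/
noncomputable def gaussian (n : ℕ) : Measure (Fin n → ℝ) :=
  Measure.pi fun _ => gaussianReal 0 1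

/-- The operator (spectral) norm of a square real matrix. -/
noncomputable def matOpNorm {m : ℕ} (M : Matrix (Fin m) (Fin m) ℝ) : ℝ :=
  ‖LinearMap.toContinuousLinearMap (Matrix.toEuclideanLin M)‖

/-- The `L²(γ_m)`-closure of the subspace of (elements represented by) polynomials of
total degree at most `t`. -/
noncomputable def polySub (m t : ℕ) : Submodule ℝ (Lp ℝ 2 (gaussian m)) :=
  (Submodule.span ℝ {h : Lp ℝ 2 (gaussian m) |
    ∃ p : MvPolynomial (Fin m) ℝ, p.totalDegree ≤ t ∧
      ∀ᵐ x ∂(gaussian m), h x = MvPolynomial.eval x p}).topologicalClosure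

open Matrix

instance isProbabilityMeasure_gaussian (n : ℕ) : IsProbabilityMeasure (gaussian n) := by
  unfold gaussian; infer_instance

lemma charFunDual_gaussian {n : ℕ} (L : StrongDual ℝ (Fin n → ℝ)) (ξ : Fin n → ℝ)
    (hL : ∀ x, L x = ξ ⬝ᵥ x) :
    charFunDual (gaussian n) L = Complex.exp (((-(1 / 2) * (ξ ⬝ᵥ ξ) : ℝ) : ℂ)) := by
  unfold gaussian
  rw [charFunDual_pi]
  have key (i : Fin n) :
      charFunDual (gaussianReal 0 1) (L.comp (.single ℝ (fun _ : Fin n => ℝ) i)) =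
        Complex.exp (((-(1 / 2) * (ξ i * ξ i) : ℝ) : ℂ)) := by
    have h := charFun_gaussianReal (μ := 0) (v := 1) (ξ i)
    rw [charFun_apply_real] at h
    rw [charFunDual_apply]
    have h' (v : ℝ) : ((L.comp (.single ℝ (fun _ : Fin n => ℝ) i)) v) = ξ i * v := by
      simp [hL]
    simp_rw [h']
    push_cast
    rw [h]
    congr 1
    push_cast
    ring
  simp_rw [key]
  rw [← Complex.exp_sum, dotProduct, Finset.mul_sum]
  push_cast
  rfl

lemma strongDual_prod_eq_dotProduct {m : ℕ} (L : StrongDual ℝ ((Fin m → ℝ) × (Fin m → ℝ))) :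
    ∃ ξ η : Fin m → ℝ, ∀ a b, L (a, b) = ξ ⬝ᵥ a + η ⬝ᵥ b := by
  have single (L : (Fin m → ℝ) →ₗ[ℝ] ℝ) : ∃ ξ : Fin m → ℝ, ∀ a, L a = ξ ⬝ᵥ a := by
    refine ⟨fun i => L (Pi.single i 1), fun a => ?_⟩
    rw [LinearMap.pi_apply_eq_sum_univ L a, dotProduct]
    refine Finset.sum_congr rfl fun i _ => ?_
    rw [smul_eq_mul, mul_comm]
    congr 2
    ext j
    simp [Pi.single_apply, eq_comm]
  obtain ⟨ξ, hξ⟩ := single (L.toLinearMap ∘ₗ LinearMap.inl ℝ _ _)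
  obtain ⟨η, hη⟩ := single (L.toLinearMap ∘ₗ LinearMap.inr ℝ _ _)
  refine ⟨ξ, η, fun a b => ?_⟩
  rw [← hξ, ← hη]
  simp [← map_add]

/-- A matrix as a continuous linear map between function spaces. -/
noncomputable def mulVecCLM {m n : ℕ} (A : Matrix (Fin m) (Fin n) ℝ) :
    (Fin n → ℝ) →L[ℝ] (Fin m → ℝ) :=
  LinearMap.toContinuousLinearMap A.mulVecLin

@[simp]
lemma mulVecCLM_apply {m n : ℕ} (A : Matrix (Fin m) (Fin n) ℝ) (x : Fin n → ℝ) :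
    mulVecCLM A x = A *ᵥ x := rfl

lemma measurable_mulVec {m n : ℕ} (A : Matrix (Fin m) (Fin n) ℝ) :
    Measurable fun x : Fin n → ℝ => A *ᵥ x :=
  (mulVecCLM A).continuous.measurable

lemma dotProduct_mulVec_self {m n : ℕ} (A : Matrix (Fin m) (Fin n) ℝ) (ξ : Fin m → ℝ)
    (B : Matrix (Fin m) (Fin n) ℝ) (η : Fin m → ℝ) :
    (Aᵀ *ᵥ ξ) ⬝ᵥ (Bᵀ *ᵥ η) = ξ ⬝ᵥ ((A * Bᵀ) *ᵥ η) := by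
  rw [mulVec_transpose, ← dotProduct_mulVec, mulVec_mulVec]

lemma map_pair_gaussian {m n : ℕ} {U V : Matrix (Fin m) (Fin n) ℝ}
    (hU : U * Uᵀ = 1) (hV : V * Vᵀ = 1) {r s : ℝ} (hrs : r ^ 2 + s ^ 2 = 1)
    {K B : Matrix (Fin m) (Fin m) ℝ} (hKB : Kᵀ * K + B * Bᵀ = 1)
    (hUV : U * Vᵀ = r ^ 2 • K) :
    (gaussian n).map (fun x => (U *ᵥ x, V *ᵥ x)) =
      (((gaussian m).prod (gaussian m)).prod ((gaussian m).prod (gaussian m))).map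
        (fun p => (r • p.1.1 + s • p.2.1, r • (Kᵀ *ᵥ p.1.1 + B *ᵥ p.1.2) + s • p.2.2)) := by
  let A₁ : (Fin n → ℝ) →L[ℝ] (Fin m → ℝ) × (Fin m → ℝ) := (mulVecCLM U).prod (mulVecCLM V)
  let F := Fin m → ℝ
  let p₁ := ContinuousLinearMap.fst ℝ F F
  let p₂ := ContinuousLinearMap.snd ℝ F F
  let q₁ := ContinuousLinearMap.fst ℝ (F × F) (F × F)
  let q₂ := ContinuousLinearMap.snd ℝ (F × F) (F × F)
  let A₂ : (F × F) × (F × F) →L[ℝ] F × F :=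
    (r • p₁.comp q₁ + s • p₁.comp q₂).prod
      (r • ((mulVecCLM Kᵀ).comp (p₁.comp q₁) + (mulVecCLM B).comp (p₂.comp q₁)) +
        s • p₂.comp q₂)
  change (gaussian n).map A₁ = Measure.map A₂ _
  have : IsProbabilityMeasure ((gaussian n).map A₁) :=
    Measure.isProbabilityMeasure_map A₁.continuous.aemeasurable
  have : IsProbabilityMeasure
      ((((gaussian m).prod (gaussian m)).prod ((gaussian m).prod (gaussian m))).map A₂) :=
    Measure.isProbabilityMeasure_map A₂.continuous.aemeasurable
  refine Measure.ext_of_charFunDual (funext fun L => ?_)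
  obtain ⟨ξ, η, hL⟩ := strongDual_prod_eq_dotProduct L
  rw [charFunDual_map, charFunDual_map, charFunDual_prod, charFunDual_prod, charFunDual_prod,
    charFunDual_gaussian _ (Uᵀ *ᵥ ξ + Vᵀ *ᵥ η), charFunDual_gaussian _ (r • ξ + r • (K *ᵥ η)),
    charFunDual_gaussian _ (r • (Bᵀ *ᵥ η)), charFunDual_gaussian _ (s • ξ),
    charFunDual_gaussian _ (s • η)]
  · rw [← Complex.exp_add, ← Complex.exp_add, ← Complex.exp_add]
    norm_cast
    congr 1
    have e1 : (Uᵀ *ᵥ ξ) ⬝ᵥ (Uᵀ *ᵥ ξ) = ξ ⬝ᵥ ξ := by rw [dotProduct_mulVec_self, hU, one_mulVec]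
    have e2 : (Vᵀ *ᵥ η) ⬝ᵥ (Vᵀ *ᵥ η) = η ⬝ᵥ η := by rw [dotProduct_mulVec_self, hV, one_mulVec]
    have e3 : (Uᵀ *ᵥ ξ) ⬝ᵥ (Vᵀ *ᵥ η) = r ^ 2 * (ξ ⬝ᵥ (K *ᵥ η)) := by
      rw [dotProduct_mulVec_self, hUV, smul_mulVec, dotProduct_smul, smul_eq_mul]
    have e4 : (K *ᵥ η) ⬝ᵥ (K *ᵥ η) + (Bᵀ *ᵥ η) ⬝ᵥ (Bᵀ *ᵥ η) = η ⬝ᵥ η := by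
      have := dotProduct_mulVec_self Kᵀ η Kᵀ η
      rw [transpose_transpose] at this
      rw [this, dotProduct_mulVec_self, ← dotProduct_add, ← add_mulVec, hKB, one_mulVec]
    simp only [add_dotProduct, dotProduct_add, smul_dotProduct, dotProduct_smul, smul_eq_mul, e1,
      e2, e3, dotProduct_comm (Vᵀ *ᵥ η) (Uᵀ *ᵥ ξ), dotProduct_comm (K *ᵥ η) ξ]
    linear_combination (-1 / 2 * r ^ 2) * (-e4) +
      (1 / 2) * (ξ ⬝ᵥ ξ + η ⬝ᵥ η) * hrs
  · intro x
    simp [A₂, p₁, p₂, q₁, q₂, F, hL]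
  · intro x
    simp [A₂, p₁, p₂, q₁, q₂, F, hL]
  · intro x
    simp [A₂, p₁, p₂, q₁, q₂, F, hL, mulVec_transpose, dotProduct_mulVec]
  · intro x
    simp [A₂, p₁, p₂, q₁, q₂, F, hL, dotProduct_mulVec, vecMul_transpose]
  · intro x
    simp [A₁, hL, mulVec_transpose, dotProduct_mulVec]

lemma map_swap_gaussian (m : ℕ) {r s : ℝ} (hrs : r ^ 2 + s ^ 2 = 1) :
    ((gaussian m).prod (gaussian m)).map (fun p => (p.1, r • p.1 + s • p.2)) =
      ((gaussian m).prod (gaussian m)).map (fun p => (r • p.1 + s • p.2, p.1)) := by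
  let F := Fin m → ℝ
  let p₁ := ContinuousLinearMap.fst ℝ F F
  let p₂ := ContinuousLinearMap.snd ℝ F F
  let A₁ : F × F →L[ℝ] F × F := p₁.prod (r • p₁ + s • p₂)
  let A₂ : F × F →L[ℝ] F × F := (r • p₁ + s • p₂).prod p₁
  change Measure.map A₁ _ = Measure.map A₂ _
  have : IsProbabilityMeasure (((gaussian m).prod (gaussian m)).map A₁) :=
    Measure.isProbabilityMeasure_map A₁.continuous.aemeasurable
  have : IsProbabilityMeasure (((gaussian m).prod (gaussian m)).map A₂) :=
    Measure.isProbabilityMeasure_map A₂.continuous.aemeasurable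
  refine Measure.ext_of_charFunDual (funext fun L => ?_)
  obtain ⟨ξ, η, hL⟩ := strongDual_prod_eq_dotProduct L
  rw [charFunDual_map, charFunDual_map, charFunDual_prod, charFunDual_prod,
    charFunDual_gaussian _ (ξ + r • η), charFunDual_gaussian _ (s • η),
    charFunDual_gaussian _ (r • ξ + η), charFunDual_gaussian _ (s • ξ)]
  · rw [← Complex.exp_add, ← Complex.exp_add]
    norm_cast
    congr 1
    simp only [add_dotProduct, dotProduct_add, smul_dotProduct, dotProduct_smul, smul_eq_mul]
    rw [dotProduct_comm η ξ]
    linear_combination (1 / 2) * (ξ ⬝ᵥ ξ - η ⬝ᵥ η) * hrs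
  all_goals
    intro x
    simp [A₁, A₂, p₁, p₂, F, hL]

lemma measurePreserving_ou (m : ℕ) {r s : ℝ} (hrs : r ^ 2 + s ^ 2 = 1) :
    MeasurePreserving (fun p : (Fin m → ℝ) × (Fin m → ℝ) => r • p.1 + s • p.2)
      ((gaussian m).prod (gaussian m)) (gaussian m) := by
  refine ⟨by fun_prop, ?_⟩
  have h := congrArg (Measure.map Prod.fst) (map_swap_gaussian m hrs)
  rw [Measure.map_map (by fun_prop) (by fun_prop), Measure.map_map (by fun_prop) (by fun_prop)] at h
  rw [show (fun p : (Fin m → ℝ) × (Fin m → ℝ) => r • p.1 + s • p.2) =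
    Prod.fst ∘ fun p => (r • p.1 + s • p.2, p.1) from rfl, ← h]
  exact measurePreserving_fst.map_eq

lemma measurePreserving_coupling {m : ℕ} {K B : Matrix (Fin m) (Fin m) ℝ}
    (hKB : Kᵀ * K + B * Bᵀ = 1) :
    MeasurePreserving (fun p : (Fin m → ℝ) × (Fin m → ℝ) => Kᵀ *ᵥ p.1 + B *ᵥ p.2)
      ((gaussian m).prod (gaussian m)) (gaussian m) := by
  let F := Fin m → ℝ
  let A : F × F →L[ℝ] F := (mulVecCLM Kᵀ).comp (.fst ℝ F F) + (mulVecCLM B).comp (.snd ℝ F F)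
  refine ⟨A.continuous.measurable, ?_⟩
  change Measure.map A _ = _
  have : IsProbabilityMeasure (((gaussian m).prod (gaussian m)).map A) :=
    Measure.isProbabilityMeasure_map A.continuous.aemeasurable
  refine Measure.ext_of_charFunDual (funext fun L => ?_)
  obtain ⟨ξ, η, hL⟩ := strongDual_prod_eq_dotProduct (L.comp (.snd ℝ F F))
  replace hL (b : F) : L b = η ⬝ᵥ b := by simpa using hL 0 b
  rw [charFunDual_map, charFunDual_prod, charFunDual_gaussian _ (K *ᵥ η),
    charFunDual_gaussian _ (Bᵀ *ᵥ η), charFunDual_gaussian _ η hL]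
  · rw [← Complex.exp_add]
    norm_cast
    congr 1
    have := dotProduct_mulVec_self Kᵀ η Kᵀ η
    rw [transpose_transpose] at this
    rw [← mul_add, this, dotProduct_mulVec_self, ← dotProduct_add, ← add_mulVec, hKB, one_mulVec]
  · intro x
    simp [A, F, hL, mulVec_transpose, dotProduct_mulVec]
  · intro x
    simp [A, F, hL, dotProduct_mulVec, vecMul_transpose]

lemma measurePreserving_mulVec {m n : ℕ} {U : Matrix (Fin m) (Fin n) ℝ} (hU : U * Uᵀ = 1) :
    MeasurePreserving (fun x => U *ᵥ x) (gaussian n) (gaussian m) := by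
  refine ⟨measurable_mulVec U, ?_⟩
  have h := congrArg (Measure.map Prod.fst) (map_pair_gaussian hU hU (r := 1) (s := 0) (by simp)
    (K := 1) (B := 0) (by simp) (by simp [hU]))
  rw [Measure.map_map (by fun_prop) ((measurable_mulVec U).prodMk (measurable_mulVec U)),
    Measure.map_map (by fun_prop) (by simp; fun_prop)] at h
  refine h.trans ?_
  simp only [one_smul, zero_smul, add_zero]
  exact (measurePreserving_fst.comp measurePreserving_fst).map_eq

lemma strongDual_eq_dotProduct {m : ℕ} (L : StrongDual ℝ (Fin m → ℝ)) :
    ∃ ξ : Fin m → ℝ, ∀ a, L a = ξ ⬝ᵥ a := by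
  obtain ⟨ξ, η, h⟩ := strongDual_prod_eq_dotProduct (L.comp (.fst ℝ (Fin m → ℝ) (Fin m → ℝ)))
  exact ⟨ξ, fun a => by simpa using h a 0⟩

instance isGaussian_gaussian (m : ℕ) : IsGaussian (gaussian m) := by
  refine isGaussian_of_map_eq_gaussianReal fun L => ?_
  obtain ⟨ξ, hξ⟩ := strongDual_eq_dotProduct L
  have hnn : 0 ≤ ξ ⬝ᵥ ξ := Finset.sum_nonneg fun i _ => mul_self_nonneg _
  refine ⟨0, (ξ ⬝ᵥ ξ).toNNReal, Measure.ext_of_charFun (funext fun t => ?_)⟩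
  rw [charFun_map_eq_charFunDual_smul, charFunDual_gaussian _ (t • ξ) (by simp [hξ]),
    charFun_gaussianReal]
  congr 1
  simp only [smul_dotProduct, dotProduct_smul, smul_eq_mul, Real.coe_toNNReal _ hnn]
  push_cast
  ring

open scoped ENNReal

lemma memLp_eval {m : ℕ} (p : MvPolynomial (Fin m) ℝ) :
    ∀ q : ℝ≥0∞, q ≠ ∞ → MemLp (fun x => MvPolynomial.eval x p) q (gaussian m) := by
  induction p using MvPolynomial.induction_on with
  | C a => intro q _; simpa using memLp_const a
  | add p₁ p₂ h₁ h₂ => intro q hq; simpa [Pi.add_def] using (h₁ q hq).add (h₂ q hq)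
  | mul_X p i h =>
    intro q hq
    have hq2 : 2 * q ≠ ∞ := ENNReal.mul_ne_top (by simp) hq
    have : ENNReal.HolderTriple (2 * q) (2 * q) q := by
      refine ⟨?_⟩
      rw [ENNReal.mul_inv (by simp) (by simp), ← add_mul, ENNReal.inv_two_add_inv_two, one_mul]
    have hX := IsGaussian.memLp_dual (gaussian m) (.proj (φ := fun _ : Fin m => ℝ) i) (2 * q) hq2
    simpa using hX.mul' (h (2 * q) hq2)

/-- The element of `L²(γ_m)` represented by a polynomial. -/
noncomputable def polyLp {m : ℕ} (p : MvPolynomial (Fin m) ℝ) : Lp ℝ 2 (gaussian m) :=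
  (memLp_eval p 2 (by simp)).toLp

lemma coeFn_polyLp {m : ℕ} (p : MvPolynomial (Fin m) ℝ) :
    polyLp p =ᵐ[gaussian m] fun x => MvPolynomial.eval x p :=
  MemLp.coeFn_toLp _

lemma eq_polyLp {m : ℕ} {p : MvPolynomial (Fin m) ℝ} {h : Lp ℝ 2 (gaussian m)}
    (hp : ∀ᵐ x ∂(gaussian m), h x = MvPolynomial.eval x p) : h = polyLp p := by
  refine Lp.ext ?_
  filter_upwards [hp, coeFn_polyLp p] with x h₁ h₂
  rw [h₁, h₂]

lemma polyLp_add {m : ℕ} (p q : MvPolynomial (Fin m) ℝ) :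
    polyLp (p + q) = polyLp p + polyLp q := by
  refine (eq_polyLp ?_).symm
  filter_upwards [Lp.coeFn_add (polyLp p) (polyLp q), coeFn_polyLp p, coeFn_polyLp q]
    with x h h₁ h₂
  rw [h, Pi.add_apply, h₁, h₂, map_add]

lemma polyLp_smul {m : ℕ} (c : ℝ) (p : MvPolynomial (Fin m) ℝ) :
    polyLp (c • p) = c • polyLp p := by
  refine (eq_polyLp ?_).symm
  filter_upwards [Lp.coeFn_smul c (polyLp p), coeFn_polyLp p] with x h h₁
  rw [h, Pi.smul_apply, h₁, MvPolynomial.smul_eval, smul_eq_mul]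

lemma inner_eq_integral_mul {α : Type*} {mα : MeasurableSpace α} {μ : Measure α}
    (f g : Lp ℝ 2 μ) : inner ℝ f g = ∫ x, f x * g x ∂μ := by
  rw [L2.inner_def]
  simp [mul_comm]

lemma integrable_exp_abs_dual {m : ℕ} (L : StrongDual ℝ (Fin m → ℝ)) (t : ℝ) :
    Integrable (fun x => Real.exp (t * |L x|)) (gaussian m) := by
  have key (s : ℝ) : Integrable (fun x => Real.exp (s * L x)) (gaussian m) := by
    have h : Integrable (fun y => Real.exp (s * y)) ((gaussian m).map L) := by
      rw [IsGaussian.map_eq_gaussianReal L]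
      exact integrable_exp_mul_gaussianReal s
    exact h.comp_measurable L.continuous.measurable
  exact integrable_exp_mul_abs (key t) (by simpa using key (-t))

lemma integral_cexp_mul_eq_zero {m : ℕ} {f : Lp ℝ 2 (gaussian m)}
    (hf : ∀ p : MvPolynomial (Fin m) ℝ, inner ℝ (polyLp p) f = 0)
    (L : StrongDual ℝ (Fin m → ℝ)) :
    ∫ x, Complex.exp (L x * Complex.I) * (f x : ℂ) ∂(gaussian m) = 0 := by
  obtain ⟨ξ, hξ⟩ := strongDual_eq_dotProduct L
  have hL : Measurable L := L.continuous.measurable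
  have hfm : AEStronglyMeasurable (fun x => (f x : ℂ)) (gaussian m) :=
    Complex.continuous_ofReal.comp_aestronglyMeasurable (Lp.aestronglyMeasurable f)
  have hpow (k : ℕ) : ∫ x, L x ^ k * f x ∂(gaussian m) = 0 := by
    rw [← hf ((∑ i, MvPolynomial.C (ξ i) * MvPolynomial.X i) ^ k), inner_eq_integral_mul]
    refine integral_congr_ae ?_
    filter_upwards [coeFn_polyLp ((∑ i, MvPolynomial.C (ξ i) * MvPolynomial.X i) ^ k)] with x hx
    rw [hx, hξ]
    simp [dotProduct]
  have hsum := hasSum_integral_of_dominated_convergence (μ := gaussian m)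
    (F := fun (k : ℕ) x => (L x * Complex.I) ^ k / (k.factorial : ℂ) * (f x : ℂ))
    (f := fun x => Complex.exp (L x * Complex.I) * (f x : ℂ))
    (fun k x => |L x| ^ k / k.factorial * |f x|) ?_ ?_ ?_ ?_ ?_
  · refine hsum.unique ?_
    convert hasSum_zero with k
    have (x : Fin m → ℝ) : ((L x : ℂ) * Complex.I) ^ k / (k.factorial : ℂ) * (f x : ℂ) =
        Complex.I ^ k / (k.factorial : ℂ) * ((L x ^ k * f x : ℝ) : ℂ) := by
      push_cast
      ring
    simp_rw [this]
    rw [integral_const_mul, integral_complex_ofReal, hpow]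
    simp
  · intro k
    exact (Measurable.aestronglyMeasurable (by fun_prop)).mul hfm
  · intro k
    filter_upwards with x
    simp
  · filter_upwards with x
    exact (Real.summable_pow_div_factorial _).mul_right _
  · have (x : Fin m → ℝ) : ∑' k : ℕ, |L x| ^ k / k.factorial * |f x| =
        Real.exp (|L x|) * |f x| := by
      rw [tsum_mul_right, Real.exp_eq_exp_ℝ, NormedSpace.exp_eq_tsum_div]
    simp_rw [this]
    have hexp : MemLp (fun x => Real.exp (|L x|)) 2 (gaussian m) := by
      rw [memLp_two_iff_integrable_sq (Measurable.aestronglyMeasurable (by fun_prop))]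
      refine (integrable_exp_abs_dual L 2).congr ?_
      filter_upwards with x
      rw [← Real.exp_nat_mul]
      simp
    exact hexp.integrable_mul (Lp.memLp f).abs
  · filter_upwards with x
    refine HasSum.mul_right _ ?_
    rw [Complex.exp_eq_exp_ℂ]
    exact NormedSpace.expSeries_div_hasSum_exp _

lemma eq_zero_of_inner_polyLp_eq_zero {m : ℕ} {f : Lp ℝ 2 (gaussian m)}
    (hf : ∀ p : MvPolynomial (Fin m) ℝ, inner ℝ (polyLp p) f = 0) : f = 0 := by
  have hfi : Integrable f (gaussian m) := (Lp.memLp f).integrable (by norm_num)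
  have : IsFiniteMeasure ((gaussian m).withDensity fun x => ENNReal.ofReal (f x)) :=
    isFiniteMeasure_withDensity_ofReal hfi.2
  have : IsFiniteMeasure ((gaussian m).withDensity fun x => ENNReal.ofReal (-f x)) :=
    isFiniteMeasure_withDensity_ofReal hfi.neg.2
  have hfm : AEMeasurable f (gaussian m) := (Lp.aestronglyMeasurable f).aemeasurable
  have hfm' : AEMeasurable (fun x => -f x) (gaussian m) := hfm.neg
  have key : (gaussian m).withDensity (fun x => ENNReal.ofReal (f x)) =
      (gaussian m).withDensity fun x => ENNReal.ofReal (-f x) := by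
    refine Measure.ext_of_charFunDual (funext fun L => ?_)
    have hL : Measurable L := L.continuous.measurable
    have hint {h : (Fin m → ℝ) → ℝ} (hh : Integrable h (gaussian m)) : Integrable
        (fun x => h x • Complex.exp (L x * Complex.I)) (gaussian m) := by
      refine hh.smul_bdd 1 (Measurable.aestronglyMeasurable (by fun_prop)) ?_
      filter_upwards with x
      rw [Complex.norm_exp_ofReal_mul_I]
    rw [charFunDual_apply, charFunDual_apply]
    simp_rw [ENNReal.ofReal]
    rw [integral_withDensity_eq_integral_smul₀ hfm.real_toNNReal,
      integral_withDensity_eq_integral_smul₀ hfm'.real_toNNReal]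
    simp_rw [NNReal.smul_def]
    rw [← sub_eq_zero, ← integral_sub, ← integral_cexp_mul_eq_zero hf L]
    · refine integral_congr_ae ?_
      filter_upwards with x
      rw [← sub_smul, Real.coe_toNNReal', Real.coe_toNNReal', Complex.real_smul, mul_comm]
      congr 2
      exact posPart_sub_negPart (f x)
    · exact hint hfi.real_toNNReal
    · exact hint hfi.neg.real_toNNReal
  rw [withDensity_eq_iff_of_sigmaFinite hfm.ennreal_ofReal hfm'.ennreal_ofReal] at key
  refine Lp.ext ?_
  filter_upwards [key, Lp.coeFn_zero ℝ 2 (gaussian m)] with x hx h0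
  rw [h0, Pi.zero_apply]
  rcases lt_trichotomy (f x) 0 with h | h | h
  · rw [ENNReal.ofReal_of_nonpos h.le, eq_comm, ENNReal.ofReal_eq_zero] at hx
    linarith
  · exact h
  · rw [ENNReal.ofReal_of_nonpos (by linarith : -f x ≤ 0), ENNReal.ofReal_eq_zero] at hx
    linarith

/-- The polynomials of total degree less than `t`. -/
noncomputable def lowDegree (m : ℕ) : ℕ → Submodule ℝ (MvPolynomial (Fin m) ℝ)
  | 0 => ⊥
  | t + 1 => MvPolynomial.restrictTotalDegree (Fin m) ℝ t

lemma mem_lowDegree_succ {m t : ℕ} {p : MvPolynomial (Fin m) ℝ} :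
    p ∈ lowDegree m (t + 1) ↔ p.totalDegree ≤ t :=
  MvPolynomial.mem_restrictTotalDegree _ _ _

lemma lowDegree_mono (m : ℕ) : Monotone (lowDegree m) := by
  refine monotone_nat_of_le_succ fun t p hp => ?_
  cases t with
  | zero => rw [show p = 0 from hp]; exact zero_mem _
  | succ t => exact mem_lowDegree_succ.2 ((mem_lowDegree_succ.1 hp).trans t.le_succ)

lemma mul_X_mem_lowDegree {m t : ℕ} {p : MvPolynomial (Fin m) ℝ} (hp : p ∈ lowDegree m t)
    (i : Fin m) : p * MvPolynomial.X i ∈ lowDegree m (t + 1) := by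
  cases t with
  | zero => rw [show p = 0 from hp, zero_mul]; exact zero_mem _
  | succ t =>
    refine mem_lowDegree_succ.2 ((MvPolynomial.totalDegree_mul _ _).trans ?_)
    rw [MvPolynomial.totalDegree_X]
    exact Nat.add_le_add_right (mem_lowDegree_succ.1 hp) 1

lemma eval_smul_add_smul {m : ℕ} (r s : ℝ) (y w : Fin m → ℝ) (p : MvPolynomial (Fin m) ℝ) :
    MvPolynomial.eval (r • y + s • w) p = MvPolynomial.eval w (MvPolynomial.bind₁
      (fun i => MvPolynomial.C (r * y i) + MvPolynomial.C s * MvPolynomial.X i) p) := by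
  simp only [MvPolynomial.eval, MvPolynomial.eval₂Hom_bind₁]
  congr 2
  ext i
  simp

lemma integrable_eval_mul_eval {m : ℕ} (r s : ℝ) (y : Fin m → ℝ)
    (p u : MvPolynomial (Fin m) ℝ) :
    Integrable (fun w => MvPolynomial.eval (r • y + s • w) p * MvPolynomial.eval w u)
      (gaussian m) := by
  simp_rw [eval_smul_add_smul, ← map_mul]
  exact memLp_one_iff_integrable.1 (memLp_eval _ 1 (by simp))

/-- Integrating `p (r y + s w) u(w)` over the Gaussian variable `w` gives a polynomial in `y`
that equals `rᵗ p(y) 𝔼 u` up to terms of degree less than `t`. -/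
def OuExpansion {m : ℕ} (r s : ℝ) (t : ℕ) (p : MvPolynomial (Fin m) ℝ) : Prop :=
  ∀ u : MvPolynomial (Fin m) ℝ, ∃ q ∈ lowDegree m t, ∀ y : Fin m → ℝ,
    ∫ w, MvPolynomial.eval (r • y + s • w) p * MvPolynomial.eval w u ∂(gaussian m) =
      r ^ t * MvPolynomial.eval y p * ∫ w, MvPolynomial.eval w u ∂(gaussian m) +
        MvPolynomial.eval y q

lemma OuExpansion.add {m t : ℕ} {r s : ℝ} {p₁ p₂ : MvPolynomial (Fin m) ℝ}
    (h₁ : OuExpansion r s t p₁) (h₂ : OuExpansion r s t p₂) : OuExpansion r s t (p₁ + p₂) := by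
  intro u
  obtain ⟨q₁, hq₁, e₁⟩ := h₁ u
  obtain ⟨q₂, hq₂, e₂⟩ := h₂ u
  refine ⟨q₁ + q₂, add_mem hq₁ hq₂, fun y => ?_⟩
  simp only [map_add, add_mul]
  rw [integral_add (integrable_eval_mul_eval ..) (integrable_eval_mul_eval ..), e₁, e₂]
  ring

lemma ouExpansion_zero {m : ℕ} (r s : ℝ) (t : ℕ) :
    OuExpansion r s t (0 : MvPolynomial (Fin m) ℝ) :=
  fun u => ⟨0, zero_mem _, by simp⟩

lemma OuExpansion.mul_X {m t : ℕ} {r s : ℝ} {p : MvPolynomial (Fin m) ℝ}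
    (h : OuExpansion r s t p) (hp : p.totalDegree ≤ t) (i : Fin m) :
    OuExpansion r s (t + 1) (p * MvPolynomial.X i) := by
  intro u
  obtain ⟨q₁, hq₁, e₁⟩ := h u
  obtain ⟨q₂, hq₂, e₂⟩ := h (MvPolynomial.X i * u)
  set c := ∫ w, MvPolynomial.eval w (MvPolynomial.X i * u) ∂(gaussian m)
  refine ⟨r • (q₁ * MvPolynomial.X i) + (s * (r ^ t * c)) • p + s • q₂, ?_, fun y => ?_⟩
  · exact add_mem (add_mem (Submodule.smul_mem _ _ (mul_X_mem_lowDegree hq₁ i))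
      (Submodule.smul_mem _ _ (mem_lowDegree_succ.2 hp)))
      (Submodule.smul_mem _ _ (lowDegree_mono m t.le_succ hq₂))
  · have (w : Fin m → ℝ) : MvPolynomial.eval (r • y + s • w) (p * MvPolynomial.X i) *
        MvPolynomial.eval w u =
        r * y i * (MvPolynomial.eval (r • y + s • w) p * MvPolynomial.eval w u) +
        s * (MvPolynomial.eval (r • y + s • w) p *
          MvPolynomial.eval w (MvPolynomial.X i * u)) := by
      simp only [map_mul, MvPolynomial.eval_X, Pi.add_apply, Pi.smul_apply, smul_eq_mul]
      ring
    simp_rw [this]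
    rw [integral_add ((integrable_eval_mul_eval ..).const_mul _)
      ((integrable_eval_mul_eval ..).const_mul _), integral_const_mul, integral_const_mul, e₁, e₂]
    simp only [map_mul, map_add, MvPolynomial.eval_X, MvPolynomial.smul_eval]
    ring

lemma OuExpansion.mono {m t t' : ℕ} {r s : ℝ} {p : MvPolynomial (Fin m) ℝ}
    (h : OuExpansion r s t p) (hp : p.totalDegree ≤ t) (ht : t ≤ t') :
    OuExpansion r s t' p := by
  rcases ht.eq_or_lt with rfl | ht
  · exact h
  intro u
  obtain ⟨q, hq, e⟩ := h u
  set c := ∫ w, MvPolynomial.eval w u ∂(gaussian m)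
  refine ⟨((r ^ t - r ^ t') * c) • p + q, ?_, fun y => ?_⟩
  · exact add_mem (Submodule.smul_mem _ _ (lowDegree_mono m ht (mem_lowDegree_succ.2 hp)))
      (lowDegree_mono m ht.le hq)
  · rw [e, map_add, MvPolynomial.smul_eval]
    ring

lemma ouExpansion_monomial {m : ℕ} (r s : ℝ) (α : Fin m →₀ ℕ) (a : ℝ) :
    OuExpansion r s (MvPolynomial.monomial α a).totalDegree (MvPolynomial.monomial α a) := by
  refine MvPolynomial.induction_on_monomial
    (motive := fun p => OuExpansion r s p.totalDegree p) (fun a => ?_) (fun p i h => ?_) α a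
  · refine fun u => ⟨0, zero_mem _, fun y => ?_⟩
    simp [integral_const_mul]
  · rcases eq_or_ne p 0 with rfl | hp
    · rw [zero_mul]
      exact ouExpansion_zero r s _
    · rw [MvPolynomial.totalDegree_mul_of_isDomain hp (MvPolynomial.X_ne_zero i),
        MvPolynomial.totalDegree_X]
      exact h.mul_X le_rfl i

lemma ouExpansion_of_totalDegree_le {m t : ℕ} (r s : ℝ) {p : MvPolynomial (Fin m) ℝ}
    (hp : p.totalDegree ≤ t) : OuExpansion r s t p := by
  rw [← MvPolynomial.support_sum_monomial_coeff p]
  refine Finset.sum_induction _ _ (fun _ _ => OuExpansion.add) (ouExpansion_zero r s t) fun α hα => ?_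
  refine (ouExpansion_monomial r s α _).mono le_rfl (le_trans ?_ hp)
  rw [MvPolynomial.totalDegree_monomial _ (MvPolynomial.mem_support_iff.1 hα)]
  exact MvPolynomial.le_totalDegree hα

/-- The Ornstein–Uhlenbeck operator `g ↦ 𝔼_w g(r y + s w)` on `L²(γ_m)`. -/
noncomputable def ouOp (m : ℕ) {r s : ℝ} (hrs : r ^ 2 + s ^ 2 = 1) :
    Lp ℝ 2 (gaussian m) →L[ℝ] Lp ℝ 2 (gaussian m) :=
  (ContinuousLinearMap.adjoint (Lp.compMeasurePreservingₗᵢ ℝ (E := ℝ) (p := 2) Prod.fst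
    (measurePreserving_fst (μ := gaussian m) (ν := gaussian m))).toContinuousLinearMap).comp
  (Lp.compMeasurePreservingₗᵢ ℝ (E := ℝ) (p := 2) _
    (measurePreserving_ou m hrs)).toContinuousLinearMap

lemma inner_compMeasurePreserving {α β γ : Type*} {mα : MeasurableSpace α}
    {mβ : MeasurableSpace β} {mγ : MeasurableSpace γ} {μ : Measure α} {ν : Measure β}
    {κ : Measure γ} {φ : α → β} {ψ : α → γ} (hφ : MeasurePreserving φ μ ν)
    (hψ : MeasurePreserving ψ μ κ) (f : Lp ℝ 2 ν) (g : Lp ℝ 2 κ) :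
    inner ℝ (Lp.compMeasurePreservingₗᵢ ℝ φ hφ f) (Lp.compMeasurePreservingₗᵢ ℝ ψ hψ g) =
      ∫ x, f (φ x) * g (ψ x) ∂μ := by
  rw [inner_eq_integral_mul]
  refine integral_congr_ae ?_
  filter_upwards [Lp.coeFn_compMeasurePreserving f hφ, Lp.coeFn_compMeasurePreserving g hψ]
    with x h₁ h₂
  exact congrArg₂ (· * ·) h₁ h₂

lemma integrable_comp_mul_comp {α β γ : Type*} {mα : MeasurableSpace α}
    {mβ : MeasurableSpace β} {mγ : MeasurableSpace γ} {μ : Measure α} {ν : Measure β}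
    {κ : Measure γ} {φ : α → β} {ψ : α → γ} (hφ : MeasurePreserving φ μ ν)
    (hψ : MeasurePreserving ψ μ κ) (f : Lp ℝ 2 ν) (g : Lp ℝ 2 κ) :
    Integrable (fun x => f (φ x) * g (ψ x)) μ :=
  ((Lp.memLp f).comp_measurePreserving hφ).integrable_mul
    ((Lp.memLp g).comp_measurePreserving hψ)

lemma inner_ouOp {m : ℕ} {r s : ℝ} (hrs : r ^ 2 + s ^ 2 = 1) (f g : Lp ℝ 2 (gaussian m)) :
    inner ℝ f (ouOp m hrs g) =
      ∫ p, f p.1 * g (r • p.1 + s • p.2) ∂((gaussian m).prod (gaussian m)) := by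
  rw [ouOp, ContinuousLinearMap.comp_apply, ContinuousLinearMap.adjoint_inner_right]
  exact inner_compMeasurePreserving measurePreserving_fst (measurePreserving_ou m hrs) f g

lemma inner_ouOp_comm {m : ℕ} {r s : ℝ} (hrs : r ^ 2 + s ^ 2 = 1) (f g : Lp ℝ 2 (gaussian m)) :
    inner ℝ f (ouOp m hrs g) = inner ℝ (ouOp m hrs f) g := by
  have hm : Measurable fun z : (Fin m → ℝ) × (Fin m → ℝ) => f z.1 * g z.2 :=
    ((Lp.stronglyMeasurable f).measurable.comp measurable_fst).mul
      ((Lp.stronglyMeasurable g).measurable.comp measurable_snd)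
  rw [real_inner_comm _ (ouOp m hrs f), inner_ouOp, inner_ouOp]
  have h := congrArg (fun μ => ∫ z, f z.1 * g z.2 ∂μ) (map_swap_gaussian m hrs)
  rw [integral_map (by fun_prop) hm.aestronglyMeasurable,
    integral_map (by fun_prop) hm.aestronglyMeasurable] at h
  simpa [mul_comm] using h

lemma ouOp_polyLp_of_integral_eq {m : ℕ} {r s : ℝ} (hrs : r ^ 2 + s ^ 2 = 1)
    {p q : MvPolynomial (Fin m) ℝ}
    (h : ∀ y, ∫ w, MvPolynomial.eval (r • y + s • w) p ∂(gaussian m) = MvPolynomial.eval y q) :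
    ouOp m hrs (polyLp p) = polyLp q := by
  refine ext_inner_left ℝ fun f => ?_
  rw [inner_ouOp, inner_eq_integral_mul]
  have hae : (fun z : (Fin m → ℝ) × (Fin m → ℝ) => f z.1 * polyLp p (r • z.1 + s • z.2))
      =ᵐ[(gaussian m).prod (gaussian m)]
      fun z => f z.1 * MvPolynomial.eval (r • z.1 + s • z.2) p := by
    filter_upwards [(measurePreserving_ou m hrs).quasiMeasurePreserving.ae (coeFn_polyLp p)]
      with z hz
    rw [hz]
  rw [integral_congr_ae hae, integral_prod _ ((integrable_comp_mul_comp measurePreserving_fst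
    (measurePreserving_ou m hrs) f (polyLp p)).congr hae)]
  refine integral_congr_ae ?_
  filter_upwards [coeFn_polyLp q] with y hy
  rw [hy, ← h, integral_const_mul]

lemma exists_ouOp_polyLp {m t : ℕ} {r s : ℝ} (hrs : r ^ 2 + s ^ 2 = 1)
    {p : MvPolynomial (Fin m) ℝ} (hp : p.totalDegree ≤ t) :
    ∃ q ∈ lowDegree m t,
      (∀ y, ∫ w, MvPolynomial.eval (r • y + s • w) p ∂(gaussian m) =
        MvPolynomial.eval y (r ^ t • p + q)) ∧
      ouOp m hrs (polyLp p) = r ^ t • polyLp p + polyLp q := by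
  obtain ⟨q, hq, h⟩ := ouExpansion_of_totalDegree_le r s hp 1
  have h' (y : Fin m → ℝ) : ∫ w, MvPolynomial.eval (r • y + s • w) p ∂(gaussian m) =
      MvPolynomial.eval y (r ^ t • p + q) := by
    simpa [MvPolynomial.smul_eval] using h y
  exact ⟨q, hq, h', by rw [ouOp_polyLp_of_integral_eq hrs h', polyLp_add, polyLp_smul]⟩

/-- The closed span of the polynomials of total degree less than `t` in `L²(γ_m)`. -/
noncomputable def lowSub (m : ℕ) : ℕ → Submodule ℝ (Lp ℝ 2 (gaussian m))
  | 0 => ⊥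
  | t + 1 => polySub m t

lemma polyLp_mem_polySub {m t : ℕ} {p : MvPolynomial (Fin m) ℝ} (hp : p.totalDegree ≤ t) :
    polyLp p ∈ polySub m t :=
  Submodule.le_topologicalClosure _ (Submodule.subset_span ⟨p, hp, coeFn_polyLp p⟩)

lemma isClosed_polySub (m t : ℕ) : IsClosed (polySub m t : Set (Lp ℝ 2 (gaussian m))) :=
  Submodule.isClosed_topologicalClosure _

lemma isClosed_lowSub (m t : ℕ) : IsClosed (lowSub m t : Set (Lp ℝ 2 (gaussian m))) := by
  cases t with
  | zero => exact isClosed_singleton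
  | succ t => exact isClosed_polySub m t

lemma polyLp_mem_lowSub {m t : ℕ} {p : MvPolynomial (Fin m) ℝ} (hp : p ∈ lowDegree m t) :
    polyLp p ∈ lowSub m t := by
  cases t with
  | zero =>
    rw [show p = 0 from hp, show polyLp (0 : MvPolynomial (Fin m) ℝ) = 0 by
      simpa using polyLp_smul 0 (0 : MvPolynomial (Fin m) ℝ)]
    exact zero_mem _
  | succ t => exact polyLp_mem_polySub (mem_lowDegree_succ.1 hp)

lemma polySub_mono (m : ℕ) : Monotone (polySub m) := fun _ _ hst =>
  Submodule.topologicalClosure_mono <| Submodule.span_mono fun _ ⟨p, hp, h⟩ =>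
    ⟨p, hp.trans hst, h⟩

lemma lowSub_le_polySub (m t : ℕ) : lowSub m t ≤ polySub m t := by
  cases t with
  | zero => exact bot_le
  | succ t => exact polySub_mono m t.le_succ

lemma ouOp_sub_smul_mem_lowSub {m t : ℕ} {r s : ℝ} (hrs : r ^ 2 + s ^ 2 = 1)
    {x : Lp ℝ 2 (gaussian m)} (hx : x ∈ polySub m t) :
    ouOp m hrs x - r ^ t • x ∈ lowSub m t := by
  let A := ouOp m hrs - r ^ t • ContinuousLinearMap.id ℝ (Lp ℝ 2 (gaussian m))
  have hle : polySub m t ≤ (lowSub m t).comap A.toLinearMap := by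
    refine Submodule.topologicalClosure_minimal _ (Submodule.span_le.2 ?_)
      ((isClosed_lowSub m t).preimage A.continuous)
    rintro h ⟨p, hp, hh⟩
    obtain ⟨q, hq, -, e⟩ := exists_ouOp_polyLp hrs hp
    have : A h = polyLp q := by simp [A, eq_polyLp hh, e]
    change A h ∈ lowSub m t
    rw [this]
    exact polyLp_mem_lowSub hq
  exact hle hx

lemma ouOp_mem_polySub {m t : ℕ} {r s : ℝ} (hrs : r ^ 2 + s ^ 2 = 1)
    {x : Lp ℝ 2 (gaussian m)} (hx : x ∈ polySub m t) : ouOp m hrs x ∈ polySub m t := by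
  have h := add_mem (lowSub_le_polySub m t (ouOp_sub_smul_mem_lowSub hrs hx))
    (Submodule.smul_mem _ (r ^ t) hx)
  rwa [sub_add_cancel] at h

lemma ouOp_mem_lowSub {m t : ℕ} {r s : ℝ} (hrs : r ^ 2 + s ^ 2 = 1)
    {x : Lp ℝ 2 (gaussian m)} (hx : x ∈ lowSub m t) : ouOp m hrs x ∈ lowSub m t := by
  cases t with
  | zero => rw [show x = 0 from hx, map_zero]; exact zero_mem _
  | succ t => exact ouOp_mem_polySub hrs hx

lemma ouOp_eq_smul {m t : ℕ} {r s : ℝ} (hrs : r ^ 2 + s ^ 2 = 1)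
    {x : Lp ℝ 2 (gaussian m)} (hx : x ∈ polySub m t) (hx' : x ∈ (lowSub m t)ᗮ) :
    ouOp m hrs x = r ^ t • x := by
  have hz := ouOp_sub_smul_mem_lowSub hrs hx
  set z := ouOp m hrs x - r ^ t • x with hzdef
  have : inner ℝ z z = 0 := by
    conv_lhs => rw [hzdef, ← hzdef]
    nth_rewrite 2 [hzdef]
    rw [inner_sub_right, inner_smul_right, inner_ouOp_comm,
      (Submodule.mem_orthogonal _ _).1 hx' _ (ouOp_mem_lowSub hrs hz),
      (Submodule.mem_orthogonal _ _).1 hx' _ hz]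
    simp
  exact sub_eq_zero.1 (inner_self_eq_zero.1 this)

lemma dense_range_polyLp (m : ℕ) :
    Dense (Set.range (polyLp : MvPolynomial (Fin m) ℝ → Lp ℝ 2 (gaussian m))) := by
  let ℓ : MvPolynomial (Fin m) ℝ →ₗ[ℝ] Lp ℝ 2 (gaussian m) :=
    { toFun := polyLp, map_add' := polyLp_add, map_smul' := polyLp_smul }
  have h : ℓ.range.topologicalClosure = ⊤ := by
    rw [Submodule.topologicalClosure_eq_top_iff, Submodule.eq_bot_iff]
    intro f hf
    exact eq_zero_of_inner_polyLp_eq_zero fun p =>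
      (Submodule.mem_orthogonal _ _).1 hf _ ⟨p, rfl⟩
  exact Submodule.dense_iff_topologicalClosure_eq_top.2 h

lemma inner_polyLp_le_norm_ouOp_sq {m n : ℕ} {U V : Matrix (Fin m) (Fin n) ℝ}
    (hU : U * Uᵀ = 1) (hV : V * Vᵀ = 1) {r s : ℝ} (hrs : r ^ 2 + s ^ 2 = 1)
    {K B : Matrix (Fin m) (Fin m) ℝ} (hKB : Kᵀ * K + B * Bᵀ = 1)
    (hUV : U * Vᵀ = r ^ 2 • K) (p : MvPolynomial (Fin m) ℝ) :
    inner ℝ (Lp.compMeasurePreservingₗᵢ ℝ _ (measurePreserving_mulVec hU) (polyLp p))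
      (Lp.compMeasurePreservingₗᵢ ℝ _ (measurePreserving_mulVec hV) (polyLp p)) ≤
      ‖ouOp m hrs (polyLp p)‖ ^ 2 := by
  have hUm := measurePreserving_mulVec hU
  have hVm := measurePreserving_mulVec hV
  have hZ := measurePreserving_coupling hKB
  obtain ⟨q₀, -, hq, -⟩ := exists_ouOp_polyLp hrs (le_refl p.totalDegree)
  set q := r ^ p.totalDegree • p + q₀
  rw [ouOp_polyLp_of_integral_eq hrs hq, inner_compMeasurePreserving]
  have hae : (fun x => polyLp p (U *ᵥ x) * polyLp p (V *ᵥ x)) =ᵐ[gaussian n]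
      fun x => MvPolynomial.eval (U *ᵥ x) p * MvPolynomial.eval (V *ᵥ x) p := by
    filter_upwards [hUm.quasiMeasurePreserving.ae (coeFn_polyLp p),
      hVm.quasiMeasurePreserving.ae (coeFn_polyLp p)] with x h₁ h₂
    rw [h₁, h₂]
  have hint := (integrable_comp_mul_comp hUm hVm (polyLp p) (polyLp p)).congr hae
  rw [integral_congr_ae hae]
  let F : (Fin m → ℝ) × (Fin m → ℝ) → ℝ :=
    fun z => MvPolynomial.eval z.1 p * MvPolynomial.eval z.2 p
  have hF {μ : Measure ((Fin m → ℝ) × (Fin m → ℝ))} : AEStronglyMeasurable F μ :=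
    Continuous.aestronglyMeasurable (((MvPolynomial.continuous_eval p).comp continuous_fst).mul
      ((MvPolynomial.continuous_eval p).comp continuous_snd))
  have hmUV : AEMeasurable (fun x => (U *ᵥ x, V *ᵥ x)) (gaussian n) :=
    (hUm.measurable.prodMk hVm.measurable).aemeasurable
  let Φ : ((Fin m → ℝ) × (Fin m → ℝ)) × ((Fin m → ℝ) × (Fin m → ℝ)) →
      (Fin m → ℝ) × (Fin m → ℝ) :=
    fun p => (r • p.1.1 + s • p.2.1, r • (Kᵀ *ᵥ p.1.1 + B *ᵥ p.1.2) + s • p.2.2)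
  have hΦ : Measurable Φ := by
    have := hZ.measurable
    exact Measurable.prodMk (by fun_prop)
      (((this.comp measurable_fst).const_smul r).add (by fun_prop))
  have hlaw : (gaussian n).map (fun x => (U *ᵥ x, V *ᵥ x)) = Measure.map Φ _ :=
    map_pair_gaussian hU hV hrs hKB hUV
  have hint' := (integrable_map_measure (f := fun x => (U *ᵥ x, V *ᵥ x)) hF hmUV).2 hint
  rw [hlaw, integrable_map_measure hF hΦ.aemeasurable] at hint'
  calc ∫ x, MvPolynomial.eval (U *ᵥ x) p * MvPolynomial.eval (V *ᵥ x) p ∂(gaussian n)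
      = ∫ z, F z ∂((gaussian n).map fun x => (U *ᵥ x, V *ᵥ x)) := (integral_map hmUV hF).symm
    _ = ∫ z, MvPolynomial.eval z.1 q * MvPolynomial.eval (Kᵀ *ᵥ z.1 + B *ᵥ z.2) q
          ∂((gaussian m).prod (gaussian m)) := by
        rw [hlaw, integral_map hΦ.aemeasurable hF]
        refine (integral_prod _ hint').trans (integral_congr_ae (ae_of_all _ fun z => ?_))
        simp only [F, Φ, Function.comp_apply]
        rw [← hq, ← hq, ← integral_prod_mul]
    _ = inner ℝ (Lp.compMeasurePreservingₗᵢ ℝ Prod.fst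
          (measurePreserving_fst (μ := gaussian m) (ν := gaussian m)) (polyLp q))
          (Lp.compMeasurePreservingₗᵢ ℝ _ hZ (polyLp q)) := by
        rw [inner_compMeasurePreserving]
        refine integral_congr_ae ?_
        filter_upwards [(measurePreserving_fst (μ := gaussian m)
          (ν := gaussian m)).quasiMeasurePreserving.ae (coeFn_polyLp q),
          hZ.quasiMeasurePreserving.ae (coeFn_polyLp q)] with z h₁ h₂
        rw [h₁, h₂]
    _ ≤ ‖polyLp q‖ ^ 2 := by
        refine (real_inner_le_norm _ _).trans ?_
        rw [LinearIsometry.norm_map, LinearIsometry.norm_map, sq]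

lemma integral_mul_le_norm_ouOp_sq {m n : ℕ} {U V : Matrix (Fin m) (Fin n) ℝ}
    (hU : U * Uᵀ = 1) (hV : V * Vᵀ = 1) {r s : ℝ} (hrs : r ^ 2 + s ^ 2 = 1)
    {K B : Matrix (Fin m) (Fin m) ℝ} (hKB : Kᵀ * K + B * Bᵀ = 1)
    (hUV : U * Vᵀ = r ^ 2 • K) (g : Lp ℝ 2 (gaussian m)) :
    ∫ x, g (U *ᵥ x) * g (V *ᵥ x) ∂(gaussian n) ≤ ‖ouOp m hrs g‖ ^ 2 := by
  rw [← inner_compMeasurePreserving (measurePreserving_mulVec hU) (measurePreserving_mulVec hV)]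
  refine (dense_range_polyLp m).induction ?_ ?_ g
  · rintro _ ⟨p, rfl⟩
    exact inner_polyLp_le_norm_ouOp_sq hU hV hrs hKB hUV p
  · refine isClosed_le ?_ ?_
    · exact (LinearIsometry.continuous _).inner (LinearIsometry.continuous _)
    · fun_prop

section Projections

variable {m : ℕ} {g : Lp ℝ 2 (gaussian m)} {P : ℕ → Lp ℝ 2 (gaussian m)}

/-- The degree-`t` Hermite part, as a difference of consecutive projections. -/
noncomputable def hermitePart (P : ℕ → Lp ℝ 2 (gaussian m)) (t : ℕ) : Lp ℝ 2 (gaussian m) :=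
  P t - (if t = 0 then 0 else P (t - 1))

lemma sum_hermitePart (P : ℕ → Lp ℝ 2 (gaussian m)) (N : ℕ) :
    ∑ t ∈ Finset.range (N + 1), hermitePart P t = P N := by
  induction N with
  | zero => simp [hermitePart]
  | succ N ih => rw [Finset.sum_range_succ, ih]; simp [hermitePart]

lemma hermitePart_mem (hPmem : ∀ t, P t ∈ polySub m t) (t : ℕ) :
    hermitePart P t ∈ polySub m t := by
  refine sub_mem (hPmem t) ?_
  split_ifs
  · exact zero_mem _
  · exact polySub_mono m (Nat.sub_le t 1) (hPmem _)

lemma hermitePart_mem_orthogonal (hP : ∀ t, g - P t ∈ (polySub m t)ᗮ) (t : ℕ) :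
    hermitePart P t ∈ (lowSub m t)ᗮ := by
  cases t with
  | zero => rw [lowSub, Submodule.bot_orthogonal_eq_top]; trivial
  | succ t =>
    have h := sub_mem (hP t) (Submodule.orthogonal_le (polySub_mono m t.le_succ) (hP (t + 1)))
    have e : g - P t - (g - P (t + 1)) = hermitePart P (t + 1) := by simp [hermitePart]
    rwa [e] at h

lemma norm_sum_smul_hermitePart_sq (hPmem : ∀ t, P t ∈ polySub m t)
    (hP : ∀ t, g - P t ∈ (polySub m t)ᗮ) (c : ℕ → ℝ) (N : ℕ) :
    ‖∑ t ∈ Finset.range N, c t • hermitePart P t‖ ^ 2 =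
      ∑ t ∈ Finset.range N, c t ^ 2 * ‖hermitePart P t‖ ^ 2 := by
  induction N with
  | zero => simp
  | succ N ih =>
    have h : inner ℝ (∑ t ∈ Finset.range N, c t • hermitePart P t)
        (c N • hermitePart P N) = 0 := by
      rw [inner_smul_right, (Submodule.mem_orthogonal _ _).1 (hermitePart_mem_orthogonal hP N),
        mul_zero]
      refine sum_mem fun t ht => Submodule.smul_mem _ _ ?_
      obtain ⟨k, rfl⟩ := Nat.exists_eq_add_of_lt (Finset.mem_range.1 ht)
      exact polySub_mono m (Nat.le_add_right t k) (hermitePart_mem hPmem t)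
    rw [Finset.sum_range_succ, Finset.sum_range_succ, norm_add_sq_real, h, ih, norm_smul, mul_pow,
      Real.norm_eq_abs, sq_abs]
    ring

lemma norm_projection_le (hPmem : ∀ t, P t ∈ polySub m t)
    (hP : ∀ t, g - P t ∈ (polySub m t)ᗮ) (t : ℕ) : ‖P t‖ ≤ ‖g‖ := by
  have : CompleteSpace (polySub m t) := (isClosed_polySub m t).completeSpace_coe
  rw [← Submodule.eq_starProjection_of_mem_orthogonal (hPmem t) (hP t)]
  exact Submodule.norm_starProjection_apply_le _ _

lemma tendsto_projection (hPmem : ∀ t, P t ∈ polySub m t)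
    (hP : ∀ t, g - P t ∈ (polySub m t)ᗮ) : Filter.Tendsto P Filter.atTop (nhds g) := by
  have (t : ℕ) : CompleteSpace (polySub m t) := (isClosed_polySub m t).completeSpace_coe
  have e : P = fun t => (polySub m t).starProjection g :=
    funext fun t => (Submodule.eq_starProjection_of_mem_orthogonal (hPmem t) (hP t)).symm
  rw [e]
  refine Submodule.starProjection_tendsto_self _ (polySub_mono m) g fun x _ => ?_
  refine closure_mono ?_ (dense_range_polyLp m x)
  rintro _ ⟨p, rfl⟩
  exact Submodule.mem_iSup_of_mem p.totalDegree (polyLp_mem_polySub le_rfl)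

lemma norm_ouOp_sq_le_tsum (hPmem : ∀ t, P t ∈ polySub m t)
    (hP : ∀ t, g - P t ∈ (polySub m t)ᗮ) {r s : ℝ} (hrs : r ^ 2 + s ^ 2 = 1) :
    ‖ouOp m hrs g‖ ^ 2 ≤ ∑' t : ℕ, (r ^ 2) ^ t * ‖hermitePart P t‖ ^ 2 := by
  have hr : r ^ 2 ≤ 1 := by nlinarith [sq_nonneg s]
  have hsum₁ : Summable fun t => ‖hermitePart P t‖ ^ 2 := by
    refine summable_of_sum_range_le (c := ‖g‖ ^ 2) (fun t => sq_nonneg _) fun N => ?_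
    have h := norm_sum_smul_hermitePart_sq hPmem hP (fun _ => 1) N
    simp only [one_smul, one_pow, one_mul] at h
    rw [← h]
    cases N with
    | zero => simp
    | succ N =>
      rw [sum_hermitePart]
      exact pow_le_pow_left₀ (norm_nonneg _) (norm_projection_le hPmem hP N) 2
  have hsum : Summable fun t => (r ^ 2) ^ t * ‖hermitePart P t‖ ^ 2 :=
    hsum₁.of_nonneg_of_le (fun t => by positivity) fun t =>
      mul_le_of_le_one_left (sq_nonneg _) (pow_le_one₀ (sq_nonneg _) hr)
  have hlim := (((ouOp m hrs).continuous.tendsto g).comp (tendsto_projection hPmem hP)).norm.pow 2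
  refine le_of_tendsto' hlim fun N => ?_
  have e : ouOp m hrs (P N) = ∑ t ∈ Finset.range (N + 1), r ^ t • hermitePart P t := by
    rw [← sum_hermitePart P N, map_sum]
    exact Finset.sum_congr rfl fun t _ =>
      ouOp_eq_smul hrs (hermitePart_mem hPmem t) (hermitePart_mem_orthogonal hP t)
  rw [Function.comp_apply, e, norm_sum_smul_hermitePart_sq hPmem hP]
  simp_rw [← pow_mul, mul_comm _ 2, pow_mul]
  exact hsum.sum_le_tsum _ fun t _ => by positivity

end Projections

open scoped Matrix.Norms.L2Operator in
lemma matOpNorm_eq_norm {m : ℕ} (M : Matrix (Fin m) (Fin m) ℝ) : matOpNorm M = ‖M‖ := rfl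

open scoped Matrix.Norms.L2Operator in
lemma norm_le_one_of_mul_transpose_eq_one {m n : ℕ} {U : Matrix (Fin m) (Fin n) ℝ}
    (hm : 0 < m) (hU : U * Uᵀ = 1) : ‖Uᵀ‖ ≤ 1 := by
  have : Nonempty (Fin m) := ⟨⟨0, hm⟩⟩
  have h := Matrix.l2_opNorm_conjTranspose_mul_self Uᵀ
  rw [conjTranspose_eq_transpose_of_trivial, transpose_transpose, hU, CStarRing.norm_one] at h
  nlinarith [norm_nonneg Uᵀ]

open scoped Matrix.Norms.L2Operator in
lemma matOpNorm_mul_transpose_le_one {m n : ℕ} {U V : Matrix (Fin m) (Fin n) ℝ}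
    (hm : 0 < m) (hU : U * Uᵀ = 1) (hV : V * Vᵀ = 1) : matOpNorm (U * Vᵀ) ≤ 1 := by
  rw [matOpNorm_eq_norm]
  refine (Matrix.l2_opNorm_mul _ _).trans (mul_le_one₀ ?_ (norm_nonneg _)
    (norm_le_one_of_mul_transpose_eq_one hm hV))
  rw [← Matrix.l2_opNorm_conjTranspose U, conjTranspose_eq_transpose_of_trivial]
  exact norm_le_one_of_mul_transpose_eq_one hm hU

open scoped Matrix.Norms.L2Operator MatrixOrder in
lemma exists_transpose_mul_add_mul_transpose_eq_one {m : ℕ} {K : Matrix (Fin m) (Fin m) ℝ}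
    (hK : matOpNorm K ≤ 1) : ∃ B : Matrix (Fin m) (Fin m) ℝ, Kᵀ * K + B * Bᵀ = 1 := by
  have hpsd : (1 - Kᵀ * K).PosSemidef := by
    refine Matrix.PosSemidef.of_dotProduct_mulVec_nonneg ?_ fun x => ?_
    · simp [Matrix.IsHermitian, conjTranspose_eq_transpose_of_trivial]
    · have h := (Matrix.l2_opNorm_mulVec K (WithLp.toLp 2 x)).trans
        (mul_le_of_le_one_left (norm_nonneg _) hK)
      have h2 := pow_le_pow_left₀ (norm_nonneg _) h 2
      rw [EuclideanSpace.real_norm_sq_eq, EuclideanSpace.real_norm_sq_eq] at h2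
      have e := dotProduct_mulVec_self Kᵀ x Kᵀ x
      rw [transpose_transpose] at e
      rw [sub_mulVec, dotProduct_sub, one_mulVec, star_trivial, ← e, sub_nonneg]
      simpa [dotProduct, sq] using h2
  obtain ⟨B, hB⟩ := CStarAlgebra.nonneg_iff_eq_star_mul_self.1 hpsd.nonneg
  refine ⟨Bᵀ, ?_⟩
  rw [star_eq_conjTranspose, conjTranspose_eq_transpose_of_trivial] at hB
  rw [transpose_transpose, ← hB]
  abel

open scoped Matrix.Norms.L2Operator in
lemma exists_eq_matOpNorm_smul {m : ℕ} (M : Matrix (Fin m) (Fin m) ℝ) :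
    ∃ K : Matrix (Fin m) (Fin m) ℝ, matOpNorm K ≤ 1 ∧ M = matOpNorm M • K := by
  refine ⟨‖M‖⁻¹ • M, ?_, ?_⟩
  · rw [matOpNorm_eq_norm, norm_smul, norm_inv, norm_norm]
    exact inv_mul_le_one
  · rw [matOpNorm_eq_norm]
    rcases eq_or_ne M 0 with rfl | hM
    · simp
    · rw [smul_smul, mul_inv_cancel₀ (norm_ne_zero_iff.2 hM), one_smul]

/-- Correlation lemma: for `g ∈ L²(γ_m)` and `U, V ∈ ℝ^{m×n}` with `UUᵀ = VVᵀ = I_m`,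
`E_{x∼γ_n}[g(Ux) g(Vx)] ≤ Σ_t ‖UVᵀ‖₂ᵗ ‖g^{[t]}‖₂²`, where `g^{[t]} = Π_t g − Π_{t−1} g`
and `Π_t` is the orthogonal projection onto the closure of degree-`≤ t` polynomials
(`Π_t g` is characterized by membership in `polySub m t` together with orthogonality of
`g − Π_t g` to `polySub m t`). -/
theorem stmt_1 (m n : ℕ) (hm : 0 < m) (hmn : m ≤ n)
    (g : Lp ℝ 2 (gaussian m))
    (U V : Matrix (Fin m) (Fin n) ℝ)
    (hU : U * U.transpose = 1) (hV : V * V.transpose = 1)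
    (P : ℕ → Lp ℝ 2 (gaussian m))
    (hPmem : ∀ t, P t ∈ polySub m t)
    (hPorth : ∀ t, ∀ q ∈ polySub m t,
      ∫ x, (g x - P t x) * q x ∂(gaussian m) = 0) :
    ∫ x, g (U.mulVec x) * g (V.mulVec x) ∂(gaussian n) ≤
      ∑' t : ℕ, matOpNorm (U * V.transpose) ^ t *
        ∫ x, ((P t - (if t = 0 then 0 else P (t - 1))) x) ^ 2 ∂(gaussian m) := by
  have hP (t : ℕ) : g - P t ∈ (polySub m t)ᗮ := by
    refine (Submodule.mem_orthogonal' _ _).2 fun q hq => ?_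
    rw [inner_eq_integral_mul, ← hPorth t q hq]
    refine integral_congr_ae ?_
    filter_upwards [Lp.coeFn_sub g (P t)] with x hx
    rw [hx, Pi.sub_apply]
  have hρ := matOpNorm_mul_transpose_le_one hm hU hV
  have hρ₀ : 0 ≤ matOpNorm (U * Vᵀ) := norm_nonneg _
  obtain ⟨K, hK, hMK⟩ := exists_eq_matOpNorm_smul (U * Vᵀ)
  obtain ⟨B, hB⟩ := exists_transpose_mul_add_mul_transpose_eq_one hK
  have hr := Real.sq_sqrt hρ₀
  have hrs : √(matOpNorm (U * Vᵀ)) ^ 2 + √(1 - matOpNorm (U * Vᵀ)) ^ 2 = 1 := by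
    rw [hr, Real.sq_sqrt (sub_nonneg.2 hρ)]
    ring
  refine (integral_mul_le_norm_ouOp_sq hU hV hrs hB (by rwa [hr]) g).trans
    ((norm_ouOp_sq_le_tsum hPmem hP hrs).trans_eq ?_)
  refine tsum_congr fun t => ?_
  rw [hr, ← real_inner_self_eq_norm_sq, inner_eq_integral_mul]
  simp_rw [← sq]
  rfl
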